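/- Let L be a finite set of lines in R^3 each meeting the unit ball. For 0 < u ≤ u' ≤ 1 and 0 < w ≤ w' ≤ 1, the maximal number of lines of L contained (in the sense |ℓ ∩ Π| ≥ 1/2) in a u'×w'×1 box is at most C·(u'/u)^2·(w'/w)^2 times the maximal number contained in a u×w×1 box, for an absolute constant C. -/

import Mathlib

open Metric Set MeasureTheory
open scoped ENNReal

noncomputable section

abbrev E3 := EuclideanSpace ℝ (Fin 3)

def IsLine (ℓ : Set E3) : Prop :=
  ∃ a v : E3, v ≠ 0 ∧ ℓ = {x | ∃ t : ℝ, x = a + t • v}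

/-- The axis-parallel `u × w × 1` box. -/
def baseBox (u w : ℝ) : Set E3 :=
  {x | x 0 ∈ Icc 0 u ∧ x 1 ∈ Icc 0 w ∧ x 2 ∈ Icc (0 : ℝ) 1}

/-- A `u × w × 1` box: any rigid image of the axis-parallel one. -/
def IsBox (u w : ℝ) (S : Set E3) : Prop :=
  ∃ f : E3 ≃ᵢ E3, S = f '' baseBox u w

/-- The number of lines of `L` contained in `B` in the sense that the length
(1-dimensional Hausdorff measure) of `ℓ ∩ B` is at least `1/2`. -/
def lineCount (L : Finset (Set E3)) (B : Set E3) : ℕ :=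
  Set.ncard {ℓ : Set E3 | ℓ ∈ L ∧ (1 / 2 : ℝ≥0∞) ≤ μH[1] (ℓ ∩ B)}

theorem abs_drift {x y r t : ℝ} (ht : t ∈ Icc (0:ℝ) (1/2)) (hx : |x| ≤ r) (hy : |y| ≤ r) :
    |x + t * y| ≤ 1.5 * r := by
  have h1 := abs_add_le x (t * y)
  rw [abs_mul, abs_of_nonneg ht.1] at h1
  have h2 := mul_le_mul ht.2 hy (abs_nonneg y) (by norm_num)
  linarith

theorem geomBox (u w : ℝ) (hu : 0 < u) (huw : u ≤ w) (hw : w ≤ 1) (a0 b0 a1 b1 : ℝ)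
    (hb0 : |b0| ≤ 1) (hb1 : |b1| ≤ 1) :
    ∃ B, IsBox u w B ∧ ∀ a0' b0' a1' b1' : ℝ, |a0' - a0| ≤ u / 50 → |b0' - b0| ≤ u / 50 →
      |a1' - a1| ≤ w / 50 → |b1' - b1| ≤ w / 50 → ∀ t ∈ Icc (0:ℝ) (1/2),
      (!₂[a0' + t * b0', a1' + t * b1', t] : E3) ∈ B := by
  set d : E3 := !₂[b0, b1, 1] with hd
  set e : E3 := !₂[1, 0, -b0] with he
  have hdn2 : ‖d‖ ^ 2 = b0 ^ 2 + b1 ^ 2 + 1 := by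
    rw [EuclideanSpace.norm_sq_eq]; simp [Fin.sum_univ_three, hd]
  have hen2 : ‖e‖ ^ 2 = 1 + b0 ^ 2 := by
    rw [EuclideanSpace.norm_sq_eq]; simp [Fin.sum_univ_three, he]
  have hb0' : b0 ^ 2 ≤ 1 := by rw [← sq_abs]; nlinarith [abs_nonneg b0]
  have hb1' : b1 ^ 2 ≤ 1 := by rw [← sq_abs]; nlinarith [abs_nonneg b1]
  have hd1 : 1 ≤ ‖d‖ := by nlinarith [norm_nonneg d, sq_nonneg b0, sq_nonneg b1]
  have he1 : 1 ≤ ‖e‖ := by nlinarith [norm_nonneg e, sq_nonneg b0]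
  have hd2 : ‖d‖ ≤ 1.74 := by nlinarith [norm_nonneg d]
  have hde : inner ℝ e d = 0 := by
    simp [hd, he, PiLp.inner_apply, Fin.sum_univ_three]
  have hed : inner ℝ d e = 0 := by rw [real_inner_comm]; exact hde
  let v : Fin 3 → E3 := ![‖e‖⁻¹ • e, 0, ‖d‖⁻¹ • d]
  have hon : Orthonormal ℝ (Set.domRestrict ({0, 2} : Set (Fin 3)) v) := by
    constructor
    · rintro ⟨i, hi⟩
      rcases hi with rfl | rfl
      · change ‖‖e‖⁻¹ • e‖ = 1
        rw [norm_smul, norm_inv, norm_norm, inv_mul_cancel₀ (by positivity)]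
      · change ‖‖d‖⁻¹ • d‖ = 1
        rw [norm_smul, norm_inv, norm_norm, inv_mul_cancel₀ (by positivity)]
    · rintro ⟨i, hi⟩ ⟨j, hj⟩ hij
      rcases hi with rfl | rfl <;> rcases hj with rfl | rfl
      · exact absurd rfl hij
      · change inner ℝ (‖e‖⁻¹ • e) (‖d‖⁻¹ • d) = 0
        rw [real_inner_smul_left, real_inner_smul_right, hde]; simp
      · change inner ℝ (‖d‖⁻¹ • d) (‖e‖⁻¹ • e) = 0
        rw [real_inner_smul_left, real_inner_smul_right, hed]; simp
      · exact absurd rfl hij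
  obtain ⟨bs, hbs⟩ := hon.exists_orthonormalBasis_extension_of_card_eq (by simp)
  have h0 : bs 0 = ‖e‖⁻¹ • e := hbs 0 (by simp)
  have h2 : bs 2 = ‖d‖⁻¹ • d := hbs 2 (by simp)
  have hdb : d = ‖d‖ • bs 2 := by rw [h2, smul_smul, mul_inv_cancel₀ (by positivity), one_smul]
  have i1d : inner ℝ (bs 1) d = 0 := by
    rw [hdb, inner_smul_right, bs.inner_eq_zero (by decide), mul_zero]
  have i2d : inner ℝ (bs 2) d = ‖d‖ := by
    conv_lhs => rw [hdb]
    rw [inner_smul_right, bs.inner_eq_one, mul_one]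
  have i0d : inner ℝ (bs 0) d = 0 := by
    rw [hdb, inner_smul_right, bs.inner_eq_zero (by decide), mul_zero]
  set o : E3 := !₂[a0, a1, 0] with ho
  set m : E3 := !₂[u/2, w/2, 0.06] with hm
  refine ⟨_, ⟨((IsometryEquiv.subRight m).trans bs.repr.symm.toIsometryEquiv).trans
    (IsometryEquiv.addRight o), rfl⟩, ?_⟩
  intro a0' b0' a1' b1' ha0 hb0 ha1 hb1 t ht
  set x : E3 := !₂[a0' + t * b0', a1' + t * b1', t] with hx
  set z : E3 := !₂[(a0' - a0) + t * (b0' - b0), (a1' - a1) + t * (b1' - b1), 0] with hz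
  have hxo : x - o = z + t • d := by
    ext i; fin_cases i <;> simp [hx, ho, hz, hd] <;> ring
  refine ⟨bs.repr (x - o) + m, ?_, by simp⟩
  have hz0 : |(a0' - a0) + t * (b0' - b0)| ≤ 0.03 * u := by
    have := abs_drift ht ha0 hb0
    linarith
  have hz1 : |(a1' - a1) + t * (b1' - b1)| ≤ 0.03 * w := by
    have := abs_drift ht ha1 hb1
    linarith
  have hzn : ‖z‖ ≤ 0.06 * w := by
    apply abs_le_of_sq_le_sq' _ (by linarith) |>.2
    rw [EuclideanSpace.norm_sq_eq]; simp only [Fin.sum_univ_three, hz]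
    simp
    have A := sq_le_sq' (abs_le.1 hz0).1 (abs_le.1 hz0).2
    have B := sq_le_sq' (abs_le.1 hz1).1 (abs_le.1 hz1).2
    nlinarith
  have c0 : |inner ℝ (bs 0) z| ≤ 0.03 * u := by
    have : inner ℝ (bs 0) z = ‖e‖⁻¹ * ((a0' - a0) + t * (b0' - b0)) := by
      rw [h0, real_inner_smul_left]
      congr 1
      simp [he, hz, PiLp.inner_apply, Fin.sum_univ_three]
    rw [this, abs_mul, abs_of_pos (by positivity)]
    have : ‖e‖⁻¹ ≤ 1 := inv_le_one_of_one_le₀ he1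
    exact (mul_le_of_le_one_left (abs_nonneg _) this).trans hz0
  have cc : ∀ i, |inner ℝ (bs i) z| ≤ 0.06 * w := fun i => by
    refine (abs_real_inner_le_norm _ _).trans ?_
    rw [bs.norm_eq_one, one_mul]; exact hzn
  have c1 := abs_le.1 (cc 1)
  have c2 := abs_le.1 (cc 2)
  rw [abs_le] at c0
  have htd : t * ‖d‖ ≤ 0.87 := by nlinarith [ht.1, ht.2]
  have htd0 : 0 ≤ t * ‖d‖ := mul_nonneg ht.1 (by positivity)
  have r : ∀ i, (bs.repr (x - o) + m) i = inner ℝ (bs i) z + t * inner ℝ (bs i) d + m i := by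
    intro i
    rw [PiLp.add_apply, bs.repr_apply_apply, hxo, inner_add_right, inner_smul_right]
  refine ⟨?_, ?_, ?_⟩
  · rw [r, i0d]; simp only [hm]; simp; constructor <;> linarith
  · rw [r, i1d]; simp only [hm]; simp; constructor <;> linarith
  · rw [r, i2d]; simp only [hm]; simp; constructor <;> linarith

def swp (i j : Fin 3) : E3 ≃ᵢ E3 :=
  (LinearIsometryEquiv.piLpCongrLeft 2 ℝ ℝ (Equiv.swap i j)).toIsometryEquiv

theorem swp_apply (i j k : Fin 3) (x : E3) : swp i j x k = x (Equiv.swap i j k) := by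
  simp [swp, LinearIsometryEquiv.piLpCongrLeft_apply, Equiv.piCongrLeft'_apply]

theorem geomBox' (u w : ℝ) (hu : 0 < u) (hu1 : u ≤ 1) (hw0 : 0 < w) (hw : w ≤ 1)
    (a0 b0 a1 b1 : ℝ)
    (hb0 : |b0| ≤ 1) (hb1 : |b1| ≤ 1) :
    ∃ B, IsBox u w B ∧ ∀ a0' b0' a1' b1' : ℝ, |a0' - a0| ≤ u / 50 → |b0' - b0| ≤ u / 50 →
      |a1' - a1| ≤ w / 50 → |b1' - b1| ≤ w / 50 → ∀ t ∈ Icc (0:ℝ) (1/2),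
      (!₂[a0' + t * b0', a1' + t * b1', t] : E3) ∈ B := by
  rcases le_total u w with h | h
  · exact geomBox u w hu h hw a0 b0 a1 b1 hb0 hb1
  · obtain ⟨B, ⟨f, rfl⟩, hB⟩ := geomBox w u hw0 h hu1 a1 b1 a0 b0 hb1 hb0
    refine ⟨_, ⟨((swp 0 1).trans f).trans (swp 0 1), rfl⟩, ?_⟩
    intro a0' b0' a1' b1' h1 h2 h3 h4 t ht
    obtain ⟨y, hy, hfy⟩ := hB a1' b1' a0' b0' h3 h4 h1 h2 t ht
    have ss : ∀ x, swp 0 1 (swp 0 1 x) = x := by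
      intro x; ext k; simp [swp_apply]
    refine ⟨swp 0 1 y, ?_, ?_⟩
    · refine ⟨?_, ?_, ?_⟩
      · rw [swp_apply]; exact hy.2.1
      · rw [swp_apply]; exact hy.1
      · rw [swp_apply]; exact hy.2.2
    · simp only [IsometryEquiv.trans_apply, ss, hfy]
      ext k; rw [swp_apply]; fin_cases k <;> simp
      rw [Equiv.swap_apply_of_ne_of_ne (by decide) (by decide)]; simp

theorem IsLine.image {ℓ : Set E3} (h : IsLine ℓ) (g : E3 ≃ᵢ E3) : IsLine (g '' ℓ) := by
  obtain ⟨a, v, hv, rfl⟩ := h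
  let A := g.toRealAffineIsometryEquiv
  have hA : ∀ x, g x = A x := fun x => by simp [A]
  refine ⟨g a, A.linearIsometryEquiv v, by simpa using hv, ?_⟩
  have key : ∀ t : ℝ, g (a + t • v) = g a + t • A.linearIsometryEquiv v := by
    intro t
    rw [hA, hA, add_comm a, ← vadd_eq_add, A.map_vadd, map_smul, vadd_eq_add, add_comm]
  ext x
  constructor
  · rintro ⟨_, ⟨t, rfl⟩, rfl⟩
    exact ⟨t, key t⟩
  · rintro ⟨t, rfl⟩
    exact ⟨_, ⟨t, rfl⟩, key t⟩

theorem IsLine.mem {ℓ : Set E3} (h : IsLine ℓ) {p q : E3} (hp : p ∈ ℓ) (hq : q ∈ ℓ) (s : ℝ) :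
    p + s • (q - p) ∈ ℓ := by
  obtain ⟨a, v, hv, rfl⟩ := h
  obtain ⟨t, rfl⟩ := hp
  obtain ⟨r, rfl⟩ := hq
  exact ⟨t + s * (r - t), by module⟩

theorem exists_far {ℓ B : Set E3} (h : IsLine ℓ) (hm : (1 / 2 : ℝ≥0∞) ≤ μH[1] (ℓ ∩ B)) :
    ∃ p ∈ ℓ ∩ B, ∃ q ∈ ℓ ∩ B, 0.49 ≤ dist p q := by
  by_contra! hc
  obtain ⟨a, v, hv, rfl⟩ := h
  have hv' : ‖v‖ ≠ 0 := by simpa using hv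
  set γ : ℝ → E3 := fun t => a + t • (‖v‖⁻¹ • v) with hγ
  have hiso : Isometry γ := by
    apply Isometry.of_dist_eq
    intro s t
    simp only [hγ, dist_add_left]
    rw [dist_eq_norm, ← sub_smul, norm_smul, norm_smul, norm_inv, norm_norm,
      inv_mul_cancel₀ hv', mul_one, dist_eq_norm]
  set S := {x | ∃ t : ℝ, x = a + t • v} ∩ B
  have hS : S = γ '' (γ ⁻¹' S) := by
    rw [Set.image_preimage_eq_inter_range, Set.inter_eq_left.2]
    rintro x ⟨⟨t, rfl⟩, -⟩
    refine ⟨t * ‖v‖, ?_⟩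
    simp only [hγ, smul_smul]
    rw [mul_assoc, mul_inv_cancel₀ hv', mul_one]
  rw [hS, hiso.hausdorffMeasure_image (Or.inl zero_le_one), hausdorffMeasure_real] at hm
  have := hm.trans (Real.volume_le_diam _)
  have h2 : Metric.ediam (γ ⁻¹' S) ≤ ENNReal.ofReal 0.49 := by
    apply Metric.ediam_le
    intro s hs t ht
    rw [← hiso.edist_eq, edist_dist]
    exact ENNReal.ofReal_le_ofReal (hc _ hs _ ht).le
  have h3 := this.trans h2
  have h4 : (1/2 : ℝ≥0∞) = ENNReal.ofReal (1/2) := by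
    rw [ENNReal.ofReal_div_of_pos (by norm_num)]; simp
  rw [h4, ENNReal.ofReal_le_ofReal_iff (by norm_num)] at h3
  norm_num at h3

theorem long_of_mem {ℓ B : Set E3} (a0 b0 a1 b1 : ℝ)
    (h : ∀ t ∈ Icc (0:ℝ) (1/2), (!₂[a0 + t * b0, a1 + t * b1, t] : E3) ∈ ℓ ∩ B) :
    (1 / 2 : ℝ≥0∞) ≤ μH[1] (ℓ ∩ B) := by
  have hl : LipschitzWith 1 (fun x : E3 => x 2) := by
    apply LipschitzWith.of_dist_le_mul
    intro x y
    rw [NNReal.coe_one, one_mul, dist_eq_norm, dist_eq_norm]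
    exact PiLp.norm_apply_le (x - y) 2
  have h1 := hl.hausdorffMeasure_image_le (zero_le_one) (ℓ ∩ B)
  rw [hausdorffMeasure_real] at h1
  have h2 : Icc (0:ℝ) (1/2) ⊆ (fun x : E3 => x 2) '' (ℓ ∩ B) := by
    intro t ht
    exact ⟨_, h t ht, by simp⟩
  have h3 := (measure_mono h2).trans h1
  rw [Real.volume_Icc, sub_zero, ENNReal.ofReal_div_of_pos (by norm_num)] at h3
  simpa using h3

def GoodLine (u w : ℝ) (ℓ : Set E3) (c : Fin 4 → ℝ) : Prop :=
  |c 0| ≤ 5 * u ∧ |c 1| ≤ 5 * u ∧ |c 2| ≤ 5 * w ∧ |c 3| ≤ 5 * w ∧ |c 1| ≤ 1 ∧ |c 3| ≤ 1 ∧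
    ∀ t : ℝ, (!₂[c 0 + t * c 1, c 2 + t * c 3, t] : E3) ∈ ℓ

theorem goodLine_of {u w : ℝ} {ℓ : Set E3} (h : IsLine ℓ) {p q : E3}
    (hp : p ∈ ℓ) (hq : q ∈ ℓ) (hpB : p ∈ baseBox u w) (hqB : q ∈ baseBox u w)
    (h0 : |q 0 - p 0| ≤ |q 2 - p 2|) (h1 : |q 1 - p 1| ≤ |q 2 - p 2|)
    (h2 : 1 / 4 ≤ |q 2 - p 2|) : ∃ c, GoodLine u w ℓ c := by
  have hpos : 0 < |q 2 - p 2| := by linarith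
  have hne : q 2 - p 2 ≠ 0 := abs_pos.1 hpos
  obtain ⟨⟨p0, p0'⟩, ⟨p1, p1'⟩, p2, p2'⟩ := hpB
  obtain ⟨⟨q0, q0'⟩, ⟨q1, q1'⟩, q2, q2'⟩ := hqB
  set b0 := (q 0 - p 0) / (q 2 - p 2) with hb0
  set b1 := (q 1 - p 1) / (q 2 - p 2) with hb1
  have k0 : |b0| ≤ 1 := by rw [hb0, abs_div]; exact div_le_one_of_le₀ h0 hpos.le
  have k1 : |b1| ≤ 1 := by rw [hb1, abs_div]; exact div_le_one_of_le₀ h1 hpos.le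
  have l0 : |b0| ≤ 4 * u := by
    rw [hb0, abs_div, div_le_iff₀ hpos]
    have : |q 0 - p 0| ≤ u := by rw [abs_le]; constructor <;> linarith
    nlinarith
  have l1 : |b1| ≤ 4 * w := by
    rw [hb1, abs_div, div_le_iff₀ hpos]
    have : |q 1 - p 1| ≤ w := by rw [abs_le]; constructor <;> linarith
    nlinarith
  refine ⟨![p 0 - p 2 * b0, b0, p 1 - p 2 * b1, b1], ?_, ?_, ?_, ?_, k0, k1, ?_⟩
  · simp only [Matrix.cons_val]
    rw [abs_le] at *
    constructor <;> nlinarith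
  · simp only [Matrix.cons_val]; linarith
  · simp only [Matrix.cons_val]
    rw [abs_le] at *
    constructor <;> nlinarith
  · simp only [Matrix.cons_val]; linarith
  · intro t
    convert h.mem hp hq ((t - p 2) / (q 2 - p 2)) using 1
    ext i; fin_cases i <;> simp [hb0, hb1] <;> field_simp <;> ring

theorem floor_mem {x s r : ℝ} (hs : 0 < s) (h : |x| ≤ r) :
    ⌊x / s⌋ ∈ Finset.Icc (-⌈r / s⌉) ⌈r / s⌉ := by
  rw [abs_le] at h
  rw [Finset.mem_Icc]
  constructor
  · rw [Int.le_floor]; push_cast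
    have := Int.le_ceil (r / s)
    have h2 : -(r/s) ≤ x / s := by rw [← neg_div]; gcongr; exact h.1
    linarith
  · have h2 : x / s ≤ r / s := by gcongr; exact h.2
    have := Int.floor_le (x / s)
    have h3 := Int.le_ceil (r / s)
    have : (⌊x / s⌋ : ℝ) ≤ ⌈r / s⌉ := by linarith
    exact_mod_cast this

theorem card_cells {u u' : ℝ} (hu : 0 < u) (h : u ≤ u') :
    ((Finset.Icc (-⌈5 * u' / (u / 50)⌉) ⌈5 * u' / (u / 50)⌉).card : ℝ) ≤ 600 * (u' / u) := by
  have h1 : 1 ≤ u' / u := by rw [le_div_iff₀ hu]; linarith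
  have h2 : 5 * u' / (u / 50) = 250 * (u' / u) := by field_simp; ring
  rw [h2, Int.card_Icc]
  have h3 := Int.ceil_lt_add_one (250 * (u' / u))
  have h4 : 0 ≤ ⌈250 * (u' / u)⌉ := Int.ceil_nonneg (by positivity)
  have h5 : (((⌈250 * (u' / u)⌉ + 1 - -⌈250 * (u' / u)⌉).toNat : ℤ) : ℝ)
    = 2 * (⌈250 * (u' / u)⌉ : ℝ) + 1 := by
    rw [Int.toNat_of_nonneg (by linarith)]; push_cast; ring
  rw [Int.cast_natCast] at h5
  rw [h5]; linarith

theorem close_of_floor {x y s : ℝ} (hs : 0 < s) (h : ⌊x / s⌋ = ⌊y / s⌋) : |x - y| ≤ s := by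
  have := (Int.abs_sub_lt_one_of_floor_eq_floor h).le
  rwa [← sub_div, abs_div, abs_of_pos hs, div_le_one hs] at this

theorem key (L S : Finset (Set E3)) (hSL : S ⊆ L) (g : E3 ≃ᵢ E3) (u u' w w' : ℝ)
    (hu : 0 < u) (huu : u ≤ u') (hu1 : u' ≤ 1) (hw : 0 < w) (hww : w ≤ w') (hw1 : w' ≤ 1)
    (hS : ∀ ℓ ∈ S, ∃ c, GoodLine u' w' (g '' ℓ) c) :
    ∃ B, IsBox u w B ∧
      (S.card : ℝ) ≤ 600 ^ 4 * (u' / u) ^ 2 * (w' / w) ^ 2 * (lineCount L B : ℝ) := by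
  classical
  rcases S.eq_empty_or_nonempty with rfl | hne
  · exact ⟨_, ⟨IsometryEquiv.refl _, rfl⟩, by simp; positivity⟩
  choose! c hc using hS
  let I : Finset ℤ := Finset.Icc (-⌈5 * u' / (u / 50)⌉) ⌈5 * u' / (u / 50)⌉
  let J : Finset ℤ := Finset.Icc (-⌈5 * w' / (w / 50)⌉) ⌈5 * w' / (w / 50)⌉
  let T := (I ×ˢ I) ×ˢ (J ×ˢ J)
  let F : Set E3 → (ℤ × ℤ) × (ℤ × ℤ) := fun ℓ =>
    ((⌊c ℓ 0 / (u / 50)⌋, ⌊c ℓ 1 / (u / 50)⌋), (⌊c ℓ 2 / (w / 50)⌋, ⌊c ℓ 3 / (w / 50)⌋))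
  have hu50 : 0 < u / 50 := by positivity
  have hw50 : 0 < w / 50 := by positivity
  have hF : ∀ ℓ ∈ S, F ℓ ∈ T := by
    intro ℓ hℓ
    obtain ⟨g0, g1, g2, g3, -⟩ := hc ℓ hℓ
    simp only [F, T, Finset.mem_product]
    exact ⟨⟨floor_mem hu50 g0, floor_mem hu50 g1⟩, floor_mem hw50 g2, floor_mem hw50 g3⟩
  have hTne : T.Nonempty := by
    obtain ⟨ℓ, hℓ⟩ := hne
    exact ⟨_, hF ℓ hℓ⟩
  have hTpos : 0 < (T.card : ℝ) := by exact_mod_cast hTne.card_pos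
  have hTcard : (T.card : ℝ) ≤ 600 ^ 4 * (u' / u) ^ 2 * (w' / w) ^ 2 := by
    simp only [T, Finset.card_product]
    push_cast
    have hI := card_cells hu huu
    have hJ := card_cells hw hww
    calc ((I.card : ℝ) * I.card) * (J.card * J.card)
        ≤ ((600 * (u' / u)) * (600 * (u' / u))) * ((600 * (w' / w)) * (600 * (w' / w))) := by
          have hu0 : 0 ≤ u' / u := div_nonneg (hu.le.trans huu) hu.le
          have hw0 : 0 ≤ w' / w := div_nonneg (hw.le.trans hww) hw.le
          gcongr
      _ = _ := by ring
  obtain ⟨y, hy, hcard⟩ := Finset.exists_le_card_fiber_of_nsmul_le_card_of_maps_to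
    (b := (S.card : ℝ) / T.card) hF hTne
    (by rw [nsmul_eq_mul, mul_div_cancel₀ _ hTpos.ne'])
  set Y := S.filter (fun x => F x = y) with hY
  have hYpos : 0 < (Y.card : ℝ) := by
    refine lt_of_lt_of_le ?_ hcard
    have : 0 < (S.card : ℝ) := by exact_mod_cast hne.card_pos
    positivity
  obtain ⟨ℓ₀, hℓ₀⟩ : Y.Nonempty := Finset.card_pos.1 (by exact_mod_cast hYpos)
  obtain ⟨hℓ₀S, hℓ₀y⟩ := Finset.mem_filter.1 hℓ₀
  obtain ⟨B, ⟨f, rfl⟩, hB⟩ := geomBox' u w hu (huu.trans hu1) hw (hww.trans hw1)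
    (c ℓ₀ 0) (c ℓ₀ 1) (c ℓ₀ 2) (c ℓ₀ 3) (hc ℓ₀ hℓ₀S).2.2.2.2.1 (hc ℓ₀ hℓ₀S).2.2.2.2.2.1
  refine ⟨_, ⟨f.trans g.symm, rfl⟩, ?_⟩
  have hle : Y.card ≤ lineCount L ((f.trans g.symm) '' baseBox u w) := by
    unfold lineCount
    rw [← Set.ncard_coe_finset]
    apply Set.ncard_le_ncard
    · intro ℓ hℓ
      obtain ⟨hℓS, hℓy⟩ := Finset.mem_filter.1 hℓ
      refine ⟨hSL hℓS, ?_⟩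
      rw [← g.isometry.hausdorffMeasure_image (Or.inl zero_le_one),
        Set.image_inter g.injective]
      apply long_of_mem (c ℓ 0) (c ℓ 1) (c ℓ 2) (c ℓ 3)
      intro t ht
      refine ⟨(hc ℓ hℓS).2.2.2.2.2.2 t, ?_⟩
      have hEq : F ℓ = F ℓ₀ := hℓy.trans hℓ₀y.symm
      simp only [F, Prod.mk.injEq] at hEq
      obtain ⟨⟨e0, e1⟩, e2, e3⟩ := hEq
      have := hB _ _ _ _ (close_of_floor hu50 e0) (close_of_floor hu50 e1)
        (close_of_floor hw50 e2) (close_of_floor hw50 e3) t ht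
      obtain ⟨x, hx, hfx⟩ := this
      exact ⟨g.symm (f x), ⟨x, hx, rfl⟩, by rw [g.apply_symm_apply, hfx]⟩
    · exact L.finite_toSet.subset (fun ℓ h => h.1)
  have hle' : (Y.card : ℝ) ≤ lineCount L ((f.trans g.symm) '' baseBox u w) := by exact_mod_cast hle
  rw [div_le_iff₀ hTpos] at hcard
  calc (S.card : ℝ) ≤ Y.card * T.card := hcard
    _ ≤ lineCount L ((f.trans g.symm) '' baseBox u w) * T.card := by gcongr
    _ = T.card * lineCount L ((f.trans g.symm) '' baseBox u w) := mul_comm _ _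
    _ ≤ _ := by gcongr

theorem trichotomy {u w : ℝ} (hu1 : u ≤ 1) (hw1 : w ≤ 1) {ℓ : Set E3} (h : IsLine ℓ)
    (hm : (1 / 2 : ℝ≥0∞) ≤ μH[1] (ℓ ∩ baseBox u w)) :
    (∃ c, GoodLine u w ℓ c) ∨ (1 / 4 ≤ u ∧ ∃ c, GoodLine 1 w (swp 0 2 '' ℓ) c) ∨
      (1 / 4 ≤ w ∧ ∃ c, GoodLine u 1 (swp 1 2 '' ℓ) c) := by
  obtain ⟨p, ⟨hp, hpB⟩, q, ⟨hq, hqB⟩, hd⟩ := exists_far h hm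
  have hsq : 0.24 ≤ |q 0 - p 0| ^ 2 + |q 1 - p 1| ^ 2 + |q 2 - p 2| ^ 2 := by
    have : dist p q ^ 2 = |q 0 - p 0| ^ 2 + |q 1 - p 1| ^ 2 + |q 2 - p 2| ^ 2 := by
      rw [dist_comm, dist_eq_norm, EuclideanSpace.norm_sq_eq]
      simp [Fin.sum_univ_three]
    rw [← this]; nlinarith
  have n0 := abs_nonneg (q 0 - p 0)
  have n1 := abs_nonneg (q 1 - p 1)
  have n2 := abs_nonneg (q 2 - p 2)
  obtain ⟨p0, p1, p2⟩ := id hpB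
  obtain ⟨q0, q1, q2⟩ := id hqB
  have s02 : Equiv.swap (0 : Fin 3) 2 1 = 1 := by decide
  have s12 : Equiv.swap (1 : Fin 3) 2 0 = 0 := by decide
  by_cases c2 : |q 0 - p 0| ≤ |q 2 - p 2| ∧ |q 1 - p 1| ≤ |q 2 - p 2|
  · left
    exact goodLine_of h hp hq hpB hqB c2.1 c2.2 (by nlinarith)
  right
  by_cases c0 : |q 1 - p 1| ≤ |q 0 - p 0| ∧ |q 2 - p 2| ≤ |q 0 - p 0|
  · left
    have hq4 : 1 / 4 ≤ |q 0 - p 0| := by nlinarith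
    have : |q 0 - p 0| ≤ u := by rw [abs_le]; constructor <;> linarith [p0.1, p0.2, q0.1, q0.2]
    refine ⟨by linarith, goodLine_of (h.image _) (mem_image_of_mem _ hp) (mem_image_of_mem _ hq)
      ⟨?_, ?_, ?_⟩ ⟨?_, ?_, ?_⟩ ?_ ?_ ?_⟩ <;>
      simp only [swp_apply, s02, Equiv.swap_apply_left, Equiv.swap_apply_right]
    · exact p2
    · exact p1
    · exact ⟨p0.1, p0.2.trans hu1⟩
    · exact q2
    · exact q1
    · exact ⟨q0.1, q0.2.trans hu1⟩
    · exact c0.2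
    · exact c0.1
    · exact hq4
  · right
    have c1 : |q 0 - p 0| ≤ |q 1 - p 1| ∧ |q 2 - p 2| ≤ |q 1 - p 1| := by
      rcases le_total |q 0 - p 0| |q 1 - p 1| with a | a
      · refine ⟨a, ?_⟩
        by_contra hcon
        exact c2 ⟨by linarith, by linarith⟩
      · exfalso
        have : ¬ |q 2 - p 2| ≤ |q 0 - p 0| := fun h => c0 ⟨a, h⟩
        exact c2 ⟨by linarith, by linarith⟩
    have hq4 : 1 / 4 ≤ |q 1 - p 1| := by nlinarith
    have : |q 1 - p 1| ≤ w := by rw [abs_le]; constructor <;> linarith [p1.1, p1.2, q1.1, q1.2]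
    refine ⟨by linarith, goodLine_of (h.image _) (mem_image_of_mem _ hp) (mem_image_of_mem _ hq)
      ⟨?_, ?_, ?_⟩ ⟨?_, ?_, ?_⟩ ?_ ?_ ?_⟩ <;>
      simp only [swp_apply, s12, Equiv.swap_apply_left, Equiv.swap_apply_right]
    · exact p0
    · exact p2
    · exact ⟨p1.1, p1.2.trans hw1⟩
    · exact q0
    · exact q2
    · exact ⟨q1.1, q1.2.trans hw1⟩
    · exact c1.1
    · exact c1.2
    · exact hq4

theorem sq_quarter {u u' : ℝ} (hu : 0 < u) (h : 1 / 4 ≤ u') : (1 / u) ^ 2 ≤ 16 * (u' / u) ^ 2 := by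
  rw [div_pow, div_pow, ← mul_div_assoc]
  gcongr
  nlinarith

theorem stmt5 :
    ∃ C > 0, ∀ L : Finset (Set E3),
      (∀ ℓ ∈ L, IsLine ℓ ∧ (ℓ ∩ ball (0 : E3) 1).Nonempty) →
      ∀ u u' w w' : ℝ, 0 < u → u ≤ u' → u' ≤ 1 → 0 < w → w ≤ w' → w' ≤ 1 →
      ∀ B' : Set E3, IsBox u' w' B' →
      ∃ B : Set E3, IsBox u w B ∧
        (lineCount L B' : ℝ) ≤ C * (u' / u) ^ 2 * (w' / w) ^ 2 * (lineCount L B : ℝ) := by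
  classical
  refine ⟨48 * 600 ^ 4, by norm_num, ?_⟩
  rintro L hL u u' w w' hu huu hu1 hw hww hw1 _ ⟨f, rfl⟩
  set g := f.symm with hg
  let S0 := L.filter (fun ℓ => ∃ c, GoodLine u' w' (g '' ℓ) c)
  let S1 := L.filter (fun ℓ => 1 / 4 ≤ u' ∧ ∃ c, GoodLine 1 w' ((g.trans (swp 0 2)) '' ℓ) c)
  let S2 := L.filter (fun ℓ => 1 / 4 ≤ w' ∧ ∃ c, GoodLine u' 1 ((g.trans (swp 1 2)) '' ℓ) c)
  have hcount : lineCount L (f '' baseBox u' w') ≤ S0.card + S1.card + S2.card := by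
    have h1 : lineCount L (f '' baseBox u' w') ≤ (S0 ∪ S1 ∪ S2).card := by
      unfold lineCount
      rw [← Set.ncard_coe_finset]
      apply Set.ncard_le_ncard _ (Finset.finite_toSet _)
      rintro ℓ ⟨hℓ, hm⟩
      have hm' : (1 / 2 : ℝ≥0∞) ≤ μH[1] ((g '' ℓ) ∩ baseBox u' w') := by
        rw [← g.isometry.hausdorffMeasure_image (Or.inl zero_le_one),
          Set.image_inter g.injective] at hm
        convert hm using 3
        rw [Set.image_image]; simp [hg]
      have ht := trichotomy hu1 hw1 ((hL ℓ hℓ).1.image g) hm'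
      rw [Set.image_image, Set.image_image] at ht
      simp only [Finset.coe_union, Set.mem_union, Finset.mem_coe, S0, S1, S2, Finset.mem_filter]
      rcases ht with h | h | h
      · exact Or.inl (Or.inl ⟨hℓ, h⟩)
      · exact Or.inl (Or.inr ⟨hℓ, h⟩)
      · exact Or.inr ⟨hℓ, h⟩
    have h2 := Finset.card_union_le (S0 ∪ S1) S2
    have h3 := Finset.card_union_le S0 S1
    omega
  set K : ℝ := 600 ^ 4 * (u' / u) ^ 2 * (w' / w) ^ 2 with hK
  have hK0 : 0 ≤ K := by positivity
  have triv : ∃ B, IsBox u w B := ⟨_, ⟨IsometryEquiv.refl _, rfl⟩⟩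
  obtain ⟨B0, hB0, h0⟩ : ∃ B, IsBox u w B ∧ (S0.card : ℝ) ≤ 16 * K * lineCount L B := by
    obtain ⟨B, hB, h⟩ := key L S0 (Finset.filter_subset _ _) g u u' w w' hu huu hu1 hw hww hw1
      (fun ℓ hℓ => (Finset.mem_filter.1 hℓ).2)
    refine ⟨B, hB, h.trans (mul_le_mul_of_nonneg_right ?_ (Nat.cast_nonneg _))⟩
    linarith
  obtain ⟨B1, hB1, h1⟩ : ∃ B, IsBox u w B ∧ (S1.card : ℝ) ≤ 16 * K * lineCount L B := by
    rcases S1.eq_empty_or_nonempty with he | ⟨ℓ, hℓ⟩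
    · obtain ⟨B, hB⟩ := triv
      exact ⟨B, hB, by rw [he]; simp; positivity⟩
    have hq := (Finset.mem_filter.1 hℓ).2.1
    obtain ⟨B, hB, h⟩ := key L S1 (Finset.filter_subset _ _) (g.trans (swp 0 2)) u 1 w w' hu
      (huu.trans hu1) le_rfl hw hww hw1 (fun ℓ hℓ => (Finset.mem_filter.1 hℓ).2.2)
    refine ⟨B, hB, h.trans (mul_le_mul_of_nonneg_right ?_ (Nat.cast_nonneg _))⟩
    have := mul_le_mul_of_nonneg_left (sq_quarter hu hq)
      (show 0 ≤ 600 ^ 4 * (w' / w) ^ 2 by positivity)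
    rw [hK]; linarith
  obtain ⟨B2, hB2, h2⟩ : ∃ B, IsBox u w B ∧ (S2.card : ℝ) ≤ 16 * K * lineCount L B := by
    rcases S2.eq_empty_or_nonempty with he | ⟨ℓ, hℓ⟩
    · obtain ⟨B, hB⟩ := triv
      exact ⟨B, hB, by rw [he]; simp; positivity⟩
    have hq := (Finset.mem_filter.1 hℓ).2.1
    obtain ⟨B, hB, h⟩ := key L S2 (Finset.filter_subset _ _) (g.trans (swp 1 2)) u u' w 1 hu
      huu hu1 hw (hww.trans hw1) le_rfl (fun ℓ hℓ => (Finset.mem_filter.1 hℓ).2.2)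
    refine ⟨B, hB, h.trans (mul_le_mul_of_nonneg_right ?_ (Nat.cast_nonneg _))⟩
    have := mul_le_mul_of_nonneg_left (sq_quarter hw hq)
      (show 0 ≤ 600 ^ 4 * (u' / u) ^ 2 by positivity)
    rw [hK]; linarith
  have hcount' : (lineCount L (f '' baseBox u' w') : ℝ) ≤ S0.card + S1.card + S2.card := by
    exact_mod_cast hcount
  obtain ⟨B, hB, m0, m1, m2⟩ : ∃ B, IsBox u w B ∧ lineCount L B0 ≤ lineCount L B ∧
      lineCount L B1 ≤ lineCount L B ∧ lineCount L B2 ≤ lineCount L B := by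
    rcases le_total (lineCount L B0) (lineCount L B1) with a | a <;>
    rcases le_total (lineCount L B1) (lineCount L B2) with b | b <;>
    rcases le_total (lineCount L B0) (lineCount L B2) with c | c
    · exact ⟨B2, hB2, c, b, le_rfl⟩
    · exact ⟨B2, hB2, a.trans b, b, le_rfl⟩
    · exact ⟨B1, hB1, a, le_rfl, b⟩
    · exact ⟨B1, hB1, a, le_rfl, b⟩
    · exact ⟨B2, hB2, c, b, le_rfl⟩
    · exact ⟨B0, hB0, le_rfl, a, c⟩
    · exact ⟨B2, hB2, c, a.trans c, le_rfl⟩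
    · exact ⟨B0, hB0, le_rfl, a, c⟩
  refine ⟨B, hB, ?_⟩
  have m0' : (lineCount L B0 : ℝ) ≤ lineCount L B := by exact_mod_cast m0
  have m1' : (lineCount L B1 : ℝ) ≤ lineCount L B := by exact_mod_cast m1
  have m2' : (lineCount L B2 : ℝ) ≤ lineCount L B := by exact_mod_cast m2
  have hK16 : 0 ≤ 16 * K := by positivity
  have e0 := h0.trans (mul_le_mul_of_nonneg_left m0' hK16)
  have e1 := h1.trans (mul_le_mul_of_nonneg_left m1' hK16)
  have e2 := h2.trans (mul_le_mul_of_nonneg_left m2' hK16)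
  calc (lineCount L (f '' baseBox u' w') : ℝ) ≤ 3 * (16 * K * lineCount L B) := by linarith
    _ = _ := by rw [hK]; ring
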